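/- arXiv:1209.4781 — 2 statements merged into one kernel-verified Lean document; each statement's English description precedes it below -/
import Mathlib

section
/- Let $T$ be a non-redundant decision tree structure on $n$ boolean variables with leaf set $\mathcal{L}$ of size $L$, and let $w, z \in \{0,1\}^L$ differ in exactly one coordinate, corresponding to a leaf $\ell$. Then $|\bar{s}(T_w) - \bar{s}(T_z)| \le 2\, d(\ell) \, \Pr_{x \in \{0,1\}^n}[\, \text{evaluation of } T \text{ on input } x \text{ ends at } \ell \,]$, where $x$ is uniform and $d(\ell)$ is the depth of $\ell$. -/
/-- A full binary tree: every internal vertex has exactly two children. -/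
inductive BTree : Type where
  | leaf : BTree
  | node : BTree → BTree → BTree

namespace BTree

/-- The depth of a full binary tree (maximum depth of a leaf; a single leaf has depth 0). -/
def depth : BTree → ℕ
  | .leaf => 0
  | .node l r => max l.depth r.depth + 1

/-- The minimum depth of a leaf of the tree. -/
def minDepth : BTree → ℕ
  | .leaf => 0
  | .node l r => min l.minDepth r.minDepth + 1

/-- The list of depths of the leaves of the tree. -/
def leafDepths : BTree → List ℕ
  | .leaf => [0]
  | .node l r => l.leafDepths.map (· + 1) ++ r.leafDepths.map (· + 1)

end BTree

/-- A decision tree on `n` boolean variables, with leaves labelled by elements of `α`: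
a full binary tree whose internal vertices are labelled with variables (elements of `Fin n`),
the two edges to the children corresponding to the value (false/true) of that variable. -/
inductive DTree (n : ℕ) (α : Type) : Type where
  | leaf : α → DTree n α
  | node : Fin n → DTree n α → DTree n α → DTree n α

namespace DTree

variable {n : ℕ} {α β : Type}

/-- Evaluate a decision tree on an input, returning the label of the leaf reached. -/
def eval : DTree n α → (Fin n → Bool) → α
  | .leaf a, _ => a
  | .node i l r, x => if x i then r.eval x else l.eval x

/-- Relabel the leaves of a decision tree. -/
def map (f : α → β) : DTree n α → DTree n β
  | .leaf a => .leaf (f a)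
  | .node i l r => .node i (l.map f) (r.map f)

/-- The list of leaf labels of a decision tree. -/
def leaves : DTree n α → List α
  | .leaf a => [a]
  | .node _ l r => l.leaves ++ r.leaves

/-- The depth of a decision tree (maximum depth of a leaf; a single leaf has depth 0). -/
def depth : DTree n α → ℕ
  | .leaf _ => 0
  | .node _ l r => max l.depth r.depth + 1

/-- The minimum depth of a leaf of a decision tree. -/
def minDepth : DTree n α → ℕ
  | .leaf _ => 0
  | .node _ l r => min l.minDepth r.minDepth + 1

/-- The length of the root-to-leaf path followed on input `x`
(equivalently, the depth of the leaf reached, i.e. the number of queries made). -/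
def pathLen : DTree n α → (Fin n → Bool) → ℕ
  | .leaf _, _ => 0
  | .node i l r, x => (if x i then r.pathLen x else l.pathLen x) + 1

/-- The depth of the leaf labelled `a` (assuming leaf labels are distinct). -/
def depthOf [DecidableEq α] : DTree n α → α → ℕ
  | .leaf _, _ => 0
  | .node _ l r, a => (if a ∈ l.leaves then l.depthOf a else r.depthOf a) + 1

/-- `t.NonRedundantFrom s` means no variable from `s` occurs in `t`, and no variable
occurs more than once on any root-to-leaf path of `t`. -/
def NonRedundantFrom : DTree n α → Finset (Fin n) → Prop
  | .leaf _, _ => True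
  | .node i l r, s =>
      i ∉ s ∧ l.NonRedundantFrom (insert i s) ∧ r.NonRedundantFrom (insert i s)

/-- A decision tree is non-redundant if no variable occurs more than once on any
root-to-leaf path. -/
def NonRedundant (t : DTree n α) : Prop := t.NonRedundantFrom ∅

/-- `t.Queries x i` means that on input `x`, some vertex on the root-to-leaf path
followed by `t` is labelled with variable `i`. -/
def Queries : DTree n α → (Fin n → Bool) → Fin n → Prop
  | .leaf _, _, _ => False
  | .node j l r, x, i => j = i ∨ (if x j then r.Queries x i else l.Queries x i)

end DTree

/-- The real number (0 or 1) corresponding to a boolean value. -/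
noncomputable def b2r (b : Bool) : ℝ := if b then 1 else 0

/-- Flip the `i`-th bit of the boolean string `x`. -/
def flipBit {n : ℕ} (x : Fin n → Bool) (i : Fin n) : Fin n → Bool :=
  Function.update x i (!x i)

/-- The average sensitivity (total influence) of a boolean function:
`s̄(f) = 2⁻ⁿ ∑_x ∑_i |f(x) - f(xⁱ)|`. -/
noncomputable def avgSens {n : ℕ} (f : (Fin n → Bool) → Bool) : ℝ :=
  (∑ x : Fin n → Bool, ∑ i : Fin n, |b2r (f x) - b2r (f (flipBit x i))|) / 2 ^ n

theorem DTree.eval_map' {n : ℕ} {α β : Type} (f : α → β) (t : DTree n α) (x : Fin n → Bool) :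
    (t.map f).eval x = f (t.eval x) := by
  induction t with
  | leaf a => rfl
  | node i l r ihl ihr =>
    simp only [DTree.map, DTree.eval, ihl, ihr]
    split <;> rfl

theorem DTree.eval_mem_leaves {n : ℕ} {α : Type} (t : DTree n α) (x : Fin n → Bool) :
    t.eval x ∈ t.leaves := by
  induction t with
  | leaf a => simp [DTree.eval, DTree.leaves]
  | node i l r ihl ihr =>
    simp only [DTree.leaves, DTree.eval, List.mem_append]
    split
    · exact Or.inr ihr
    · exact Or.inl ihl

theorem DTree.card_sens_le {n : ℕ} {α : Type} [DecidableEq α] (t : DTree n α)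
    (h : t.leaves.Nodup) (x : Fin n → Bool) :
    (Finset.univ.filter (fun i => t.eval x ≠ t.eval (flipBit x i))).card
      ≤ t.depthOf (t.eval x) := by
  induction t with
  | leaf a => simp [DTree.eval]
  | node j l r ihl ihr =>
    simp only [DTree.leaves, List.nodup_append] at h
    obtain ⟨hl, hr, hd⟩ := h
    have flip_ne : ∀ i, i ≠ j → flipBit x i j = x j := by
      intro i hi
      simp [flipBit, Function.update_of_ne (Ne.symm hi)]
    by_cases hx : x j = true
    · have hnot : r.eval x ∉ l.leaves := fun hm => hd _ hm _ (r.eval_mem_leaves x) rfl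
      have e : (DTree.node j l r).eval x = r.eval x := by simp [DTree.eval, hx]
      rw [e]
      simp only [DTree.depthOf, hnot, if_false]
      refine le_trans (Finset.card_le_card ?_)
        ((Finset.card_insert_le j _).trans (Nat.succ_le_succ (ihr hr)))
      intro i hi
      simp only [Finset.mem_filter, Finset.mem_univ, true_and, Finset.mem_insert] at hi ⊢
      by_cases hij : i = j
      · exact Or.inl hij
      · right
        simpa [DTree.eval, flip_ne i hij, hx] using hi
    · have hin : l.eval x ∈ l.leaves := l.eval_mem_leaves x
      have e : (DTree.node j l r).eval x = l.eval x := by simp [DTree.eval, hx]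
      rw [e]
      simp only [DTree.depthOf, hin, if_true]
      refine le_trans (Finset.card_le_card ?_)
        ((Finset.card_insert_le j _).trans (Nat.succ_le_succ (ihl hl)))
      intro i hi
      simp only [Finset.mem_filter, Finset.mem_univ, true_and, Finset.mem_insert] at hi ⊢
      by_cases hij : i = j
      · exact Or.inl hij
      · right
        simpa [DTree.eval, flip_ne i hij, hx] using hi

theorem flipBit_flipBit {n : ℕ} (x : Fin n → Bool) (i : Fin n) :
    flipBit (flipBit x i) i = x := by
  simp [flipBit]

theorem term_bound {L : ℕ} (w z : Fin L → Bool) (ℓ : Fin L)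
    (hagree : ∀ j : Fin L, j ≠ ℓ → w j = z j) (a b : Fin L) :
    |(|b2r (w a) - b2r (w b)| - |b2r (z a) - b2r (z b)|)|
      ≤ (if a = ℓ ∧ a ≠ b then (1 : ℝ) else 0) + (if b = ℓ ∧ b ≠ a then (1 : ℝ) else 0) := by
  have key : ∀ p q r s : Bool, |(|b2r p - b2r q| - |b2r r - b2r s|)| ≤ (1 : ℝ) := by
    intro p q r s
    cases p <;> cases q <;> cases r <;> cases s <;> norm_num [b2r]
  by_cases hab : a = b
  · subst hab; simp
  · by_cases ha : a = ℓ
    · have hb : b ≠ ℓ := fun h => hab (ha.trans h.symm)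
      simpa [ha, hb, Ne.symm hb] using key (w ℓ) (w b) (z ℓ) (z b)
    · by_cases hb : b = ℓ
      · simpa [ha, hb, Ne.symm ha] using key (w a) (w ℓ) (z a) (z ℓ)
      · simp [ha, hb, hagree a ha, hagree b hb]

/-- Let `T` be a non-redundant decision tree structure on `n` boolean
variables with leaf set indexed by `Fin L` (each index occurring at exactly one leaf),
and let `w, z ∈ {0,1}^L` differ in exactly one coordinate, corresponding to a leaf `ℓ`.
Then `|s̄(T_w) - s̄(T_z)| ≤ 2 d(ℓ) · Pr_x[evaluation of T on input x ends at ℓ]`,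
where `x` is uniform and `d(ℓ)` is the depth of `ℓ`. -/
theorem avgSens_flip_one_leaf (n L : ℕ) (t : DTree n (Fin L))
    (ht : t.NonRedundant) (hnodup : t.leaves.Nodup)
    (hsurj : ∀ j : Fin L, j ∈ t.leaves)
    (w z : Fin L → Bool) (ℓ : Fin L)
    (hne : w ℓ ≠ z ℓ) (hagree : ∀ j : Fin L, j ≠ ℓ → w j = z j) :
    |avgSens (fun x => (t.map w).eval x) - avgSens (fun x => (t.map z).eval x)|
      ≤ 2 * (t.depthOf ℓ : ℝ) *
          ((Set.ncard {x : Fin n → Bool | t.eval x = ℓ} : ℝ) / 2 ^ n) := by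
  classical
  simp only [DTree.eval_map', avgSens]
  rw [← sub_div, abs_div, abs_of_pos (show (0 : ℝ) < 2 ^ n by positivity), ← mul_div_assoc]
  refine div_le_div_of_nonneg_right ?_ (by positivity)
  set S : ℝ := ∑ x : Fin n → Bool, ∑ i : Fin n,
    (if t.eval x = ℓ ∧ t.eval x ≠ t.eval (flipBit x i) then (1 : ℝ) else 0) with hS
  have h2 : ∑ x : Fin n → Bool, ∑ i : Fin n,
      (if t.eval (flipBit x i) = ℓ ∧ t.eval (flipBit x i) ≠ t.eval x then (1 : ℝ) else 0) = S := by
    rw [hS, Finset.sum_comm]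
    conv_rhs => rw [Finset.sum_comm]
    refine Finset.sum_congr rfl fun i _ => ?_
    have hinv : Function.Involutive (fun x : Fin n → Bool => flipBit x i) := by
      intro x
      exact flipBit_flipBit x i
    refine Fintype.sum_equiv (Function.Involutive.toPerm _ hinv) _ _ ?_
    intro x
    simp only [Function.Involutive.coe_toPerm, flipBit_flipBit]
  have hSle : S ≤ (Set.ncard {x : Fin n → Bool | t.eval x = ℓ} : ℝ) * (t.depthOf ℓ : ℝ) := by
    have hc : Set.ncard {x : Fin n → Bool | t.eval x = ℓ}
        = (Finset.univ.filter (fun x : Fin n → Bool => t.eval x = ℓ)).card := by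
      rw [← Set.ncard_coe_finset]; simp
    rw [hc, ← nsmul_eq_mul, ← Finset.sum_const, Finset.sum_filter, hS]
    refine Finset.sum_le_sum fun x _ => ?_
    by_cases hx : t.eval x = ℓ
    · have := t.card_sens_le hnodup x
      rw [hx] at this
      simp only [hx, true_and, if_true, Finset.sum_boole]
      exact_mod_cast this
    · simp [hx]
  calc _ ≤ S + S := by
        rw [← Finset.sum_sub_distrib]
        nth_rewrite 2 [← h2]
        rw [hS, ← Finset.sum_add_distrib]
        refine (Finset.abs_sum_le_sum_abs _ _).trans (Finset.sum_le_sum fun x _ => ?_)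
        rw [← Finset.sum_sub_distrib, ← Finset.sum_add_distrib]
        refine (Finset.abs_sum_le_sum_abs _ _).trans (Finset.sum_le_sum fun i _ => ?_)
        exact term_bound w z ℓ hagree _ _
    _ ≤ _ := by linarith
end

section
/- Let $T$ be a non-redundant decision tree structure on $n$ boolean variables with leaf set $\mathcal{L}$ of size $L$, and let $w, z \in \{0,1\}^L$ differ in exactly one coordinate. Then $|\bar{s}(T_w) - \bar{s}(T_z)| \le \max_{\ell \in \mathcal{L}} d(\ell)\, 2^{1 - d(\ell)}$, where $d(\ell)$ is the depth of leaf $\ell$. -/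
namespace DTree

theorem eval_map_eq {n : ℕ} {α β : Type} (f : α → β) (t : DTree n α) (x : Fin n → Bool) :
    (t.map f).eval x = f (t.eval x) := by
  induction t with
  | leaf a => rfl
  | node i l r ihl ihr =>
    simp only [map, eval]
    split <;> assumption

theorem eval_mem_leaves_s7 {n : ℕ} {α : Type} (t : DTree n α) (x : Fin n → Bool) :
    t.eval x ∈ t.leaves := by
  induction t with
  | leaf a => simp [eval, leaves]
  | node i l r ihl ihr =>
    simp only [eval, leaves, List.mem_append]
    split
    · exact Or.inr ihr
    · exact Or.inl ihl

/-- The set of inputs reaching a given leaf is a subcube of codimension the leaf depth. -/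
theorem exists_subcube {n : ℕ} {α : Type} [DecidableEq α] (t : DTree n α) (a : α) :
    ∀ s : Finset (Fin n), t.NonRedundantFrom s → t.leaves.Nodup → a ∈ t.leaves →
      ∃ (S : Finset (Fin n)) (c : Fin n → Bool), Disjoint S s ∧ S.card = t.depthOf a ∧
        ∀ x, t.eval x = a ↔ ∀ i ∈ S, x i = c i := by
  induction t with
  | leaf b =>
    intro s _ _ ha
    simp only [leaves, List.mem_singleton] at ha
    exact ⟨∅, fun _ => false, by simp, by simp [depthOf], by simp [eval, ha]⟩
  | node j l r ihl ihr =>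
    intro s hs hnd ha
    obtain ⟨hj, hl, hr⟩ := hs
    simp only [leaves, List.nodup_append'] at hnd
    obtain ⟨ndl, ndr, hdis⟩ := hnd
    simp only [leaves, List.mem_append] at ha
    by_cases hal : a ∈ l.leaves
    · have har : a ∉ r.leaves := fun h => hdis hal h
      obtain ⟨S, c, hS, hc, he⟩ := ihl _ hl ndl hal
      rw [Finset.disjoint_insert_right] at hS
      refine ⟨insert j S, Function.update c j false, ?_, ?_, ?_⟩
      · rw [Finset.disjoint_insert_left]; exact ⟨hj, hS.2⟩
      · rw [Finset.card_insert_of_notMem hS.1, hc]; simp [depthOf, hal]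
      · intro x
        have key : (∀ i ∈ S, x i = Function.update c j false i) ↔ ∀ i ∈ S, x i = c i := by
          refine forall₂_congr fun i hi => ?_
          rw [Function.update_of_ne (fun h : i = j => hS.1 (h ▸ hi))]
        rw [Finset.forall_mem_insert, key, ← he x, Function.update_self]
        simp only [eval]
        have := eval_mem_leaves_s7 r x
        cases hx : x j
        · simp
        · simp only [if_true]
          constructor
          · intro h; rw [h] at this; exact absurd this har
          · intro h; exact absurd h.1 (by simp)
    · have har : a ∈ r.leaves := ha.resolve_left hal
      obtain ⟨S, c, hS, hc, he⟩ := ihr _ hr ndr har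
      rw [Finset.disjoint_insert_right] at hS
      refine ⟨insert j S, Function.update c j true, ?_, ?_, ?_⟩
      · rw [Finset.disjoint_insert_left]; exact ⟨hj, hS.2⟩
      · rw [Finset.card_insert_of_notMem hS.1, hc]; simp [depthOf, hal]
      · intro x
        have key : (∀ i ∈ S, x i = Function.update c j true i) ↔ ∀ i ∈ S, x i = c i := by
          refine forall₂_congr fun i hi => ?_
          rw [Function.update_of_ne (fun h : i = j => hS.1 (h ▸ hi))]
        rw [Finset.forall_mem_insert, key, ← he x, Function.update_self]
        simp only [eval]
        have := eval_mem_leaves_s7 l x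
        cases hx : x j
        · simp only [Bool.false_eq_true, if_false]
          constructor
          · intro h; rw [h] at this; exact absurd this hal
          · intro h; exact absurd h.1 (by simp)
        · simp

end DTree

theorem card_subcube {n : ℕ} (S : Finset (Fin n)) (c : Fin n → Bool) :
    (Finset.univ.filter (fun x : Fin n → Bool => ∀ i ∈ S, x i = c i)).card
      = 2 ^ (n - S.card) := by
  have h : (Finset.univ.filter (fun x : Fin n → Bool => ∀ i ∈ S, x i = c i))
      = Fintype.piFinset (fun i => if i ∈ S then {c i} else Finset.univ) := by
    ext x
    simp only [Finset.mem_filter, Finset.mem_univ, true_and, Fintype.mem_piFinset]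
    refine forall_congr' fun i => ?_
    by_cases hi : i ∈ S <;> simp [hi]
  rw [h, Fintype.card_piFinset]
  have h2 : ∀ i, (if i ∈ S then {c i} else (Finset.univ : Finset Bool)).card
      = if i ∈ S then 1 else 2 := by
    intro i; split <;> simp
  simp only [h2]
  rw [Finset.prod_ite]
  simp only [Finset.prod_const_one, one_mul, Finset.prod_const]
  congr 1
  have : Finset.univ.filter (fun i => i ∉ S) = Sᶜ := by ext; simp
  rw [this, Finset.card_compl, Fintype.card_fin]

theorem b2r_diff_bound (a b c d : Bool) :
    |(|b2r a - b2r b| - |b2r c - b2r d|)| ≤ 1 := by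
  cases a <;> cases b <;> cases c <;> cases d <;> simp [b2r]

/-- Let `T` be a non-redundant decision tree structure on `n` boolean
variables with leaf set indexed by `Fin L` (each index occurring at exactly one leaf),
and let `w, z ∈ {0,1}^L` differ in exactly one coordinate. Then
`|s̄(T_w) - s̄(T_z)| ≤ max_ℓ d(ℓ) 2^{1 - d(ℓ)}`, where `d(ℓ)` is the depth of leaf `ℓ`. -/
theorem avgSens_lipschitz_bound (n L : ℕ) (t : DTree n (Fin L))
    (ht : t.NonRedundant) (hnodup : t.leaves.Nodup)
    (hsurj : ∀ j : Fin L, j ∈ t.leaves)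
    (w z : Fin L → Bool) (hwz : hammingDist w z = 1) :
    |avgSens (fun x => (t.map w).eval x) - avgSens (fun x => (t.map z).eval x)|
      ≤ ⨆ ℓ : Fin L, (t.depthOf ℓ : ℝ) * (2 : ℝ) ^ ((1 : ℤ) - (t.depthOf ℓ : ℤ)) := by
  obtain ⟨ℓ, hℓ⟩ := Finset.card_eq_one.mp hwz
  have hne : ∀ k, k ≠ ℓ → w k = z k := by
    intro k hk
    by_contra h
    have : k ∈ Finset.univ.filter (fun i => w i ≠ z i) := by simpa using h
    rw [hℓ] at this
    exact hk (by simpa using this)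
  obtain ⟨S, c, -, hc, he⟩ := t.exists_subcube ℓ ∅ ht hnodup (hsurj ℓ)
  refine le_trans ?_ (le_ciSup (f := fun ℓ : Fin L =>
    (t.depthOf ℓ : ℝ) * (2 : ℝ) ^ ((1 : ℤ) - (t.depthOf ℓ : ℤ)))
    (Set.finite_range _).bddAbove ℓ)
  simp only [DTree.eval_map_eq]
  let ind : (Fin n → Bool) → ℝ := fun x => if t.eval x = ℓ then 1 else 0
  have hpt : ∀ x i, |(|b2r (w (t.eval x)) - b2r (w (t.eval (flipBit x i)))|
      - |b2r (z (t.eval x)) - b2r (z (t.eval (flipBit x i)))|)|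
      ≤ if i ∈ S then ind x + ind (flipBit x i) else 0 := by
    intro x i
    have hb := b2r_diff_bound (w (t.eval x)) (w (t.eval (flipBit x i)))
      (z (t.eval x)) (z (t.eval (flipBit x i)))
    by_cases h1 : t.eval x = ℓ <;> by_cases h2 : t.eval (flipBit x i) = ℓ
    · simp only [ind, h1, h2]
      split <;> norm_num
    all_goals by_cases hi : i ∈ S
    · simpa [ind, h1, h2, hi] using hb
    · exfalso
      apply h2
      rw [he] at h1 ⊢
      intro k hk
      rw [flipBit, Function.update_of_ne (fun h : k = i => hi (h ▸ hk))]
      exact h1 k hk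
    · simpa [ind, h1, h2, hi] using hb
    · exfalso
      apply h1
      rw [he] at h2 ⊢
      intro k hk
      have := h2 k hk
      rwa [flipBit, Function.update_of_ne (fun h : k = i => hi (h ▸ hk))] at this
    · simp [ind, h1, h2, hne _ h1, hne _ h2]
    · simp [hi, hne _ h1, hne _ h2]
  have hcard : ∑ x, ind x = 2 ^ (n - S.card) := by
    simp only [ind, Finset.sum_boole, he]
    rw [card_subcube]
    push_cast
    rfl
  have hflip : ∀ i, ∑ x, ind (flipBit x i) = 2 ^ (n - S.card) := by
    intro i
    rw [← hcard]
    exact Equiv.sum_comp (Function.Involutive.toPerm (fun x => flipBit x i)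
      (fun x => flipBit_flipBit x i)) ind
  have hS : S.card ≤ n := by simpa using Finset.card_le_univ S
  unfold avgSens
  rw [← sub_div, abs_div, abs_of_pos (by positivity : (0 : ℝ) < 2 ^ n),
    div_le_iff₀ (by positivity), ← Finset.sum_sub_distrib]
  simp only [← Finset.sum_sub_distrib]
  calc _ ≤ ∑ x, ∑ i, (if i ∈ S then ind x + ind (flipBit x i) else 0) := by
        refine (Finset.abs_sum_le_sum_abs _ _).trans (Finset.sum_le_sum fun x _ => ?_)
        exact (Finset.abs_sum_le_sum_abs _ _).trans (Finset.sum_le_sum fun i _ => hpt x i)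
    _ = ∑ i ∈ S, ∑ x, (ind x + ind (flipBit x i)) := by
        rw [Finset.sum_comm]
        simp only [Finset.sum_ite_irrel, Finset.sum_const_zero, Finset.sum_ite_mem, Finset.univ_inter]
    _ = (S.card : ℝ) * (2 * 2 ^ (n - S.card)) := by
        simp only [Finset.sum_add_distrib, hcard, hflip, Finset.sum_const, nsmul_eq_mul]
        ring
    _ = _ := by
        rw [← hc, mul_assoc]
        congr 1
        rw [zpow_sub₀ two_ne_zero, zpow_one, zpow_natCast]
        obtain ⟨m, hm⟩ : ∃ m, n = S.card + m := ⟨n - S.card, by omega⟩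
        have hm2 : n - S.card = m := by omega
        have hp : (2 : ℝ) ^ n = 2 ^ S.card * 2 ^ m := by rw [← pow_add, ← hm]
        rw [hm2, hp]
        field_simp
end
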